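/- arXiv:1503.07577 — 3 statements merged into one kernel-verified Lean document; each statement's English description precedes it below -/
import Mathlib

section
/- Let T be a tree on 2 × ω (i.e., a set of pairs of finite sequences of equal length, from 2^{<ω} and ω^{<ω} respectively, closed under initial segments) such that the projection p[T] = { x ∈ 2^ω : ∃y ∈ ω^ω, (x,y) ∈ [T] } is an almost disjoint family of subsets of ω (identifying elements of 2^ω with the subsets of ω they are characteristic functions of). Suppose t, s, r ∈ T are such that s and r both extend t and the first coordinates of s and r are incompatible (neither extends the other). Then there exist s', r' ∈ T with s' extending s and r' extending r such that for all s'', r'' ∈ T with s'' extending s' and r'' extending r', the intersection of the sets coded by the first coordinates of s'' and r'' equals the intersection of the sets coded by the first coordinates of s' and r'. -/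
/-- The subset of `ω` coded by a finite binary sequence `u`,
namely `{ n < length u : u n = 1 }`. -/
def codes (u : List Bool) : Set ℕ := {n | u.getD n false = true}

/-- Extension of nodes (pairs of finite sequences): both coordinates extend. -/
def NodeExt {K : Type*} (s t : List Bool × List K) : Prop := s.1 <+: t.1 ∧ s.2 <+: t.2

/-- Incompatibility of finite binary sequences: neither is an initial segment
of the other. -/
def Incomp (u v : List Bool) : Prop := ¬ u <+: v ∧ ¬ v <+: u

/-- A tree on `2 × K`: a set of pairs of finite sequences of equal length,
closed under (simultaneous) initial segments. -/
def IsTree2 {K : Type*} (T : Set (List Bool × List K)) : Prop :=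
  (∀ p ∈ T, p.1.length = p.2.length) ∧
  (∀ p ∈ T, ∀ n : ℕ, (p.1.take n, p.2.take n) ∈ T)

/-- The projection `p[T]` of the set of infinite branches of `T` onto the first
coordinate, viewed as a family of subsets of `ω`. -/
def proj {K : Type*} (T : Set (List Bool × List K)) : Set (Set ℕ) :=
  { A | ∃ (x : ℕ → Bool) (y : ℕ → K),
      (∀ n : ℕ, ((List.ofFn fun i : Fin n => x i), (List.ofFn fun i : Fin n => y i)) ∈ T) ∧
      A = {n | x n = true} }

/-- A family of subsets of `ω` is almost disjoint if any two distinct members have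
finite intersection. -/
def AlmostDisjointFam (𝒜 : Set (Set ℕ)) : Prop :=
  ∀ x ∈ 𝒜, ∀ y ∈ 𝒜, x = y ∨ (x ∩ y).Finite

/-- Two nodes are compatible if one extends the other. -/
def Compat {K : Type*} (s t : List Bool × List K) : Prop := NodeExt s t ∨ NodeExt t s

/-- `T_{[t]}`: the nodes of `T` compatible with `t`. -/
def restrictT {K : Type*} (T : Set (List Bool × List K)) (t : List Bool × List K) :
    Set (List Bool × List K) := {s ∈ T | Compat s t}

/-- `(a, b)` is a "diagonal pair" in `T`: equal lengths, first coordinates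
incompatible, intersections of coded first coordinates frozen among all extensions in
`T`, and nonempty projection above `a`. -/
def IsDiagPair {K : Type*} (T : Set (List Bool × List K)) (a b : List Bool × List K) : Prop :=
  a ∈ T ∧ b ∈ T ∧ a.1.length = b.1.length ∧ Incomp a.1 b.1 ∧
  (∀ s ∈ T, ∀ t ∈ T, NodeExt a s → NodeExt b t →
    codes s.1 ∩ codes t.1 = codes a.1 ∩ codes b.1) ∧
  (proj (restrictT T a)).Nonempty

/-- A diagonal sequence in `T` of length `m`: `(t0 i, t1 i)` for `i < m`, with each
pair a diagonal pair and `t1 i` extended by both members of the next pair. -/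
def DiagSeqUpTo {K : Type*} (T : Set (List Bool × List K)) (m : ℕ)
    (t0 t1 : ℕ → List Bool × List K) : Prop :=
  (∀ i, i < m → IsDiagPair T (t0 i) (t1 i)) ∧
  ∀ i, i + 1 < m → NodeExt (t1 i) (t0 (i + 1)) ∧ NodeExt (t1 i) (t1 (i + 1))

/-- `T` admits an infinite diagonal sequence. -/
def HasInfDiagSeq {K : Type*} (T : Set (List Bool × List K)) : Prop :=
  ∃ t0 t1 : ℕ → List Bool × List K,
    ∀ i, IsDiagPair T (t0 i) (t1 i) ∧ NodeExt (t1 i) (t0 (i + 1)) ∧ NodeExt (t1 i) (t1 (i + 1))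

theorem codes_mono {u v : List Bool} (h : u <+: v) : codes u ⊆ codes v := by
  obtain ⟨w, rfl⟩ := h
  intro n hn
  have hlt : n < u.length := by
    by_contra hge
    simp [codes, List.getElem?_eq_none (not_lt.mp hge)] at hn
  simpa [codes, List.getElem?_append_left hlt] using hn

theorem codes_subset_Iio (u : List Bool) : codes u ⊆ Set.Iio u.length := by
  intro n hn
  by_contra hge
  simp [codes, List.getElem?_eq_none (not_lt.mp hge)] at hn

theorem codes_finite (u : List Bool) : (codes u).Finite :=
  (Set.finite_Iio _).subset (codes_subset_Iio u)

theorem codes_ncard_le (u : List Bool) : (codes u).ncard ≤ u.length := by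
  simpa [Set.ncard_eq_toFinset_card'] using
    Set.ncard_le_ncard (codes_subset_Iio u) (Set.finite_Iio _)

/-- A chain of lists of unbounded length has a limit sequence. -/
theorem exists_limit_of_prefix_chain {α : Type*} [Inhabited α] (l : ℕ → List α)
    (hl : ∀ n, l n <+: l (n + 1)) (hlen : ∀ n, n ≤ (l n).length) :
    ∃ x : ℕ → α, ∀ n k, k ≤ (l n).length → List.ofFn (fun i : Fin k => x i) = (l n).take k := by
  have hmono : ∀ {m n}, m ≤ n → l m <+: l n := by
    intro m n hmn
    induction hmn with
    | refl => exact List.prefix_rfl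
    | step _ ih => exact ih.trans (hl _)
  refine ⟨fun i => (l (i + 1)).getD i default, fun n k hk => ?_⟩
  refine List.ext_getElem (by simpa using hk) fun i h₁ h₂ => ?_
  have hi : i < k := by simpa using h₁
  have hi' : i < (l (i + 1)).length := hlen (i + 1)
  have hin : i < (l n).length := hi.trans_le hk
  simp only [List.getElem_ofFn, List.getElem_take, List.getD_eq_getElem _ _ hi']
  rcases le_total (i + 1) n with h | h
  · exact (hmono h).getElem hi'
  · exact ((hmono h).getElem hin).symm

theorem NodeExt.trans {K : Type*} {a b c : List Bool × List K} (h : NodeExt a b)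
    (h' : NodeExt b c) : NodeExt a c :=
  ⟨h.1.trans h'.1, h.2.trans h'.2⟩

/-- A chain of nodes of unbounded length has a limit in the projection of the tree. -/
theorem exists_mem_proj_of_chain {K : Type*} [Inhabited K] {T : Set (List Bool × List K)}
    (hT : IsTree2 T) (a : ℕ → List Bool × List K) (ha : ∀ n, a n ∈ T)
    (hext : ∀ n, NodeExt (a n) (a (n + 1))) (hlen : ∀ n, n ≤ (a n).1.length) :
    ∃ x : ℕ → Bool, {n | x n = true} ∈ proj T ∧
      ∀ n, (a n).1 = List.ofFn fun i : Fin (a n).1.length => x i := by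
  obtain ⟨x, hx⟩ := exists_limit_of_prefix_chain (fun n => (a n).1) (fun n => (hext n).1) hlen
  have hlen₂ : ∀ n, n ≤ (a n).2.length := fun n => hT.1 _ (ha n) ▸ hlen n
  obtain ⟨y, hy⟩ := exists_limit_of_prefix_chain (fun n => (a n).2) (fun n => (hext n).2) hlen₂
  refine ⟨x, ⟨x, y, fun n => ?_, rfl⟩, fun n => by simp [hx n _ le_rfl]⟩
  rw [hx n n (hlen n), hy n n (hlen₂ n)]
  exact hT.2 _ (ha n) n

theorem codes_ofFn_subset (x : ℕ → Bool) (k : ℕ) :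
    codes (List.ofFn fun i : Fin k => x i) ⊆ {n | x n = true} := by
  intro n hn
  have hlt : n < k := by simpa using codes_subset_Iio _ hn
  simpa [codes, hlt] using hn

theorem ofFn_prefix_ofFn {α : Type*} (x : ℕ → α) {k m : ℕ} (h : k ≤ m) :
    (List.ofFn fun i : Fin k => x i) <+: List.ofFn fun i : Fin m => x i := by
  rw [List.prefix_iff_eq_take]
  exact List.ext_getElem (by simpa using h) (by simp)

/-!
STATEMENT 2 (the Claim in Lemma 2.4): if `p[T]` is almost disjoint and `s, r ∈ T`
extend `t ∈ T` with incompatible first coordinates, then there are extensions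
`s' ⊇ s`, `r' ⊇ r` in `T` freezing the intersection of the coded first coordinates
among all further extensions in `T`.
-/

theorem stabilization_claim (T : Set (List Bool × List ℕ)) (hT : IsTree2 T)
    (had : AlmostDisjointFam (proj T))
    (t s r : List Bool × List ℕ) (ht : t ∈ T) (hs : s ∈ T) (hr : r ∈ T)
    (hts : NodeExt t s) (htr : NodeExt t r) (hinc : Incomp s.1 r.1) :
    ∃ s' ∈ T, ∃ r' ∈ T, NodeExt s s' ∧ NodeExt r r' ∧
      ∀ s'' ∈ T, ∀ r'' ∈ T, NodeExt s' s'' → NodeExt r' r'' →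
        codes s''.1 ∩ codes r''.1 = codes s'.1 ∩ codes r'.1 := by
  by_contra! hcon
  let S := {p : (List Bool × List ℕ) × (List Bool × List ℕ) //
    p.1 ∈ T ∧ p.2 ∈ T ∧ NodeExt s p.1 ∧ NodeExt r p.2}
  have hstep : ∀ p : S, ∃ q : S, NodeExt p.1.1 q.1.1 ∧ NodeExt p.1.2 q.1.2 ∧
      codes p.1.1.1 ∩ codes p.1.2.1 ⊂ codes q.1.1.1 ∩ codes q.1.2.1 := by
    rintro ⟨⟨a, b⟩, ha, hb, hsa, hrb⟩
    obtain ⟨a', ha', b', hb', haa', hbb', hne⟩ := hcon a ha b hb hsa hrb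
    exact ⟨⟨(a', b'), ha', hb', hsa.trans haa', hrb.trans hbb'⟩, haa', hbb',
      (Set.inter_subset_inter (codes_mono haa'.1) (codes_mono hbb'.1)).ssubset_of_ne hne.symm⟩
  choose f hf using hstep
  let p₀ : S := ⟨(s, r), hs, hr, ⟨List.prefix_rfl, List.prefix_rfl⟩,
    ⟨List.prefix_rfl, List.prefix_rfl⟩⟩
  let p : ℕ → S := fun n => f^[n] p₀
  have hp : ∀ n, p (n + 1) = f (p n) := fun n => Function.iterate_succ_apply' f n p₀
  have hcard : ∀ n, n ≤ (codes (p n).1.1.1 ∩ codes (p n).1.2.1).ncard := by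
    intro n
    induction n with
    | zero => exact Nat.zero_le _
    | succ n ih =>
      rw [hp]
      exact ih.trans_lt (Set.ncard_lt_ncard (hf (p n)).2.2 ((codes_finite _).inter_of_left _))
  obtain ⟨x, hxT, hx⟩ := exists_mem_proj_of_chain hT (fun n => (p n).1.1) (fun n => (p n).2.1)
    (fun n => by rw [hp]; exact (hf (p n)).1) fun n => (hcard n).trans <|
      (Set.ncard_le_ncard Set.inter_subset_left (codes_finite _)).trans (codes_ncard_le _)
  obtain ⟨y, hyT, hy⟩ := exists_mem_proj_of_chain hT (fun n => (p n).1.2) (fun n => (p n).2.2.1)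
    (fun n => by rw [hp]; exact (hf (p n)).2.1) fun n => (hcard n).trans <|
      (Set.ncard_le_ncard Set.inter_subset_right (codes_finite _)).trans (codes_ncard_le _)
  rcases had _ hxT _ hyT with heq | hfin
  · have hxy : x = y := funext fun n => Bool.eq_iff_iff.mpr (Set.ext_iff.mp heq n)
    subst hxy
    have hs₀ : s.1 = List.ofFn fun i : Fin s.1.length => x i := hx 0
    have hr₀ : r.1 = List.ofFn fun i : Fin r.1.length => x i := hy 0
    rcases le_total s.1.length r.1.length with h | h
    · apply hinc.1
      rw [hs₀, hr₀]
      exact ofFn_prefix_ofFn x h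
    · apply hinc.2
      rw [hs₀, hr₀]
      exact ofFn_prefix_ofFn x h
  · have hle : ∀ n, n ≤ ({n | x n = true} ∩ {n | y n = true}).ncard := fun n => by
      refine (hcard n).trans (Set.ncard_le_ncard (Set.inter_subset_inter ?_ ?_) hfin)
      · exact (congrArg codes (hx n)).subset.trans (codes_ofFn_subset x _)
      · exact (congrArg codes (hy n)).subset.trans (codes_ofFn_subset y _)
    exact absurd (hle _) (Nat.not_succ_le_self _)
end

section
/- There are no infinite analytic maximal almost disjoint families in 𝒫(ω): if 𝒜 ⊆ 𝒫(ω) is an infinite almost disjoint family of infinite subsets of ω that is analytic as a subset of 2^ω (the continuous image of a Polish space, equivalently the projection of a closed subset of 2^ω × ω^ω), then there is an infinite z ⊆ ω such that z ∩ x is finite for all x ∈ 𝒜. -/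
/-- A family `𝒜` of subsets of `ω` is analytic if the corresponding set of
characteristic functions is an analytic subset of the Cantor space `2^ω = ℕ → Bool`
(with the product topology). -/
def IsAnalyticFam (𝒜 : Set (Set ℕ)) : Prop :=
  MeasureTheory.AnalyticSet {x : ℕ → Bool | {n | x n = true} ∈ 𝒜}

/-!
STATEMENT 6 (Mathias' theorem): there are no infinite analytic maximal almost
disjoint families: every infinite analytic almost disjoint family `𝒜` of infinite
subsets of `ω` admits an infinite `z ⊆ ω` almost disjoint from every member of `𝒜`.
-/

open Set Filter Topology MeasureTheory

/-- `R` has infinite intersection with infinitely many of the sets `a n`. -/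
def MeetsInfinitelyMany (a : ℕ → Set ℕ) (R : Set ℕ) : Prop :=
  ∃ᶠ n in atTop, (R ∩ a n).Infinite

namespace MeetsInfinitelyMany

variable {a : ℕ → Set ℕ} {R S : Set ℕ}

theorem mono (h : MeetsInfinitelyMany a R) (hRS : R ⊆ S) : MeetsInfinitelyMany a S :=
  Frequently.mono h fun _ hn => hn.mono (inter_subset_inter_left _ hRS)

theorem or_of_union (h : MeetsInfinitelyMany a (R ∪ S)) :
    MeetsInfinitelyMany a R ∨ MeetsInfinitelyMany a S := by
  unfold MeetsInfinitelyMany at *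
  rw [← frequently_or_distrib]
  refine h.mono fun n hn => ?_
  rwa [union_inter_distrib_right, infinite_union] at hn

theorem inter_or_diff (h : MeetsInfinitelyMany a R) (S : Set ℕ) :
    MeetsInfinitelyMany a (R ∩ S) ∨ MeetsInfinitelyMany a (R \ S) :=
  or_of_union (by rwa [inter_union_sdiff])

theorem not_of_finite (h : ∀ n, (R ∩ a n).Finite) : ¬ MeetsInfinitelyMany a R := fun hR =>
  let ⟨n, hn⟩ := Frequently.exists hR
  hn (h n)

theorem not_of_subset_biUnion (ha : Pairwise fun i j => (a i ∩ a j).Finite) {N : ℕ}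
    (h : R ⊆ ⋃ i < N, a i) : ¬ MeetsInfinitelyMany a R := fun hR => by
  obtain ⟨n, hNn, hn⟩ := frequently_atTop.1 hR N
  refine hn (((finite_lt_nat N).biUnion fun i hi => ha (i := i) (j := n) ?_).subset ?_)
  · exact (lt_of_lt_of_le hi hNn).ne
  · rintro m ⟨hm, hmn⟩
    obtain ⟨i, hi, hmi⟩ := mem_iUnion₂.1 (h hm)
    exact mem_iUnion₂.2 ⟨i, hi, hmi, hmn⟩

theorem exists_fusion {R : ℕ → Set ℕ} (hR : ∀ k, MeetsInfinitelyMany a (R k))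
    (hanti : Antitone R) :
    ∃ S, MeetsInfinitelyMany a S ∧ ∀ k, ∃ N, S \ R k ⊆ ⋃ i < N, a i := by
  have hex : ∀ k, ∃ n ≥ k, (R k ∩ a n).Infinite := fun k => frequently_atTop.1 (hR k) k
  choose n hkn hn using hex
  refine ⟨⋃ k, R k ∩ a (n k), frequently_atTop.2 fun k => ⟨n k, hkn k, ?_⟩, fun k => ?_⟩
  · exact (hn k).mono fun m hm => ⟨mem_iUnion.2 ⟨k, hm⟩, hm.2⟩
  · refine ⟨(Finset.range k).sup n + 1, ?_⟩
    rintro m ⟨hm, hmk⟩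
    obtain ⟨j, hmj, hmn⟩ := mem_iUnion.1 hm
    have hjk : j < k := by
      by_contra hjk
      exact hmk (hanti (not_lt.1 hjk) hmj)
    exact mem_iUnion₂.2 ⟨n j, Nat.lt_succ_of_le (Finset.le_sup (f := n) (by simpa using hjk)), hmn⟩

theorem exists_infinite_subset (ha : Pairwise fun i j => (a i ∩ a j).Finite)
    (hR : MeetsInfinitelyMany a R) :
    ∃ z ⊆ R, z.Infinite ∧ ∀ n, (z ∩ a n).Finite := by
  have hex : ∀ k, ∃ m ∈ R, k ≤ m ∧ ∀ i < k, m ∉ a i := by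
    intro k
    by_contra! hk
    have hsub : R ⊆ (R ∩ Iio k) ∪ R ∩ ⋃ i < k, a i := by
      intro m hm
      rcases lt_or_ge m k with h | h
      · exact Or.inl ⟨hm, h⟩
      · obtain ⟨i, hi, hmi⟩ := hk m hm h
        exact Or.inr ⟨hm, mem_iUnion₂.2 ⟨i, hi, hmi⟩⟩
    rcases (hR.mono hsub).or_of_union with h | h
    · exact not_of_finite (fun n => ((finite_Iio k).subset fun m hm => hm.1.2)) h
    · exact not_of_subset_biUnion ha inter_subset_right h
  choose m hmR hkm hm using hex
  refine ⟨range m, range_subset_iff.2 hmR, ?_, fun n => ?_⟩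
  · exact infinite_of_forall_exists_gt fun k => ⟨m (k + 1), mem_range_self _, hkm (k + 1)⟩
  · refine ((finite_Iic n).image m).subset ?_
    rintro _ ⟨⟨k, rfl⟩, hk⟩
    exact ⟨k, not_lt.1 fun h => hm k n h hk, rfl⟩

/-- A set meeting infinitely many `a n` can be shrunk so as to decide, for countably many
subsets `U i` of the parameter space, whether it is almost disjoint from `f y` for all `y ∈ U i`. -/
theorem exists_decides {Y : Type*} {f : Y → Set ℕ} (U : ℕ → Set Y)
    (ha : Pairwise fun i j => (a i ∩ a j).Finite) (hfa : ∀ y n, (f y ∩ a n).Finite)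
    (hR : MeetsInfinitelyMany a R) :
    ∃ S, MeetsInfinitelyMany a S ∧ ∀ i, (∀ y ∈ U i, (f y ∩ S).Finite) ∨
      ∀ S' ⊆ S, MeetsInfinitelyMany a S' → ¬ ∀ y ∈ U i, (f y ∩ S').Finite := by
  have hstep : ∀ (i : ℕ) (R : {R // MeetsInfinitelyMany a R}),
      ∃ S : {R // MeetsInfinitelyMany a R}, S.1 ⊆ R.1 ∧ ((∀ y ∈ U i, (f y ∩ S.1).Finite) ∨
        ∀ S' ⊆ S.1, MeetsInfinitelyMany a S' → ¬ ∀ y ∈ U i, (f y ∩ S').Finite) := by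
    rintro i ⟨R, hR⟩
    by_cases h : ∃ S ⊆ R, MeetsInfinitelyMany a S ∧ ∀ y ∈ U i, (f y ∩ S).Finite
    · obtain ⟨S, hSR, hS, hSU⟩ := h
      exact ⟨⟨S, hS⟩, hSR, Or.inl hSU⟩
    · exact ⟨⟨R, hR⟩, Subset.rfl, Or.inr fun S' hS' hp hk => h ⟨S', hS', hp, hk⟩⟩
  choose next hsub hnext using hstep
  let Q : ℕ → {R // MeetsInfinitelyMany a R} := fun k => Nat.rec ⟨R, hR⟩ next k
  have hQ : Antitone fun k => (Q k).1 := antitone_nat_of_succ_le fun k => hsub k (Q k)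
  obtain ⟨S, hS, hSQ⟩ := exists_fusion (fun k => (Q k).2) hQ
  refine ⟨S, hS, fun i => ?_⟩
  obtain ⟨N, hN⟩ := hSQ (i + 1)
  rcases hnext i (Q i) with h | h
  · refine Or.inl fun y hy => ?_
    refine ((h y hy).union ((finite_lt_nat N).biUnion fun n _ => hfa y n)).subset ?_
    rintro m ⟨hmy, hmS⟩
    by_cases hm : m ∈ (Q (i + 1)).1
    · exact Or.inl ⟨hmy, hm⟩
    · obtain ⟨n, hn, hmn⟩ := mem_iUnion₂.1 (hN ⟨hmS, hm⟩)
      exact Or.inr (mem_iUnion₂.2 ⟨n, hn, hmy, hmn⟩)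
  · refine Or.inr fun S' hS' hp hk => ?_
    rcases hp.inter_or_diff (Q (i + 1)).1 with hp | hp
    · exact h _ inter_subset_right hp fun y hy =>
        (hk y hy).subset (inter_subset_inter_right _ inter_subset_left)
    · exact not_of_subset_biUnion ha ((sdiff_subset_sdiff_left hS').trans hN) hp

end MeetsInfinitelyMany

/-- If any two nonempty relatively open subsets of a Polish space have parameters `y`, `y'` whose
values share arbitrarily large elements, then almost disjointness forces `f` to be constant. -/
theorem eq_of_dense_infinite_inter {C : Type*} [TopologicalSpace C] [PolishSpace C]
    {f : C → Set ℕ} (hf : ∀ m, IsClopen {y | m ∈ f y})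
    (had : ∀ y y', f y = f y' ∨ (f y ∩ f y').Finite)
    (hmeet : ∀ U V : Set C, IsOpen U → IsOpen V → U.Nonempty → V.Nonempty →
      ∀ k, ∃ m ≥ k, ∃ y ∈ U, ∃ y' ∈ V, m ∈ f y ∧ m ∈ f y') (y y' : C) : f y = f y' := by
  let W : ℕ → Set (C × C) := fun k => ⋃ m ≥ k, {y | m ∈ f y} ×ˢ {y | m ∈ f y}
  have hWo : ∀ k, IsOpen (W k) := fun k =>
    isOpen_biUnion fun m _ => (hf m).isOpen.prod (hf m).isOpen
  have hWd : ∀ k, Dense (W k) := by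
    intro k
    rw [dense_iff_inter_open]
    rintro O hO ⟨⟨p, q⟩, hpq⟩
    obtain ⟨U, V, hU, hV, hp, hq, hUV⟩ := isOpen_prod_iff.1 hO p q hpq
    obtain ⟨m, hm, y, hy, y', hy', h, h'⟩ := hmeet U V hU hV ⟨p, hp⟩ ⟨q, hq⟩ k
    exact ⟨(y, y'), hUV ⟨hy, hy'⟩, mem_iUnion₂.2 ⟨m, hm, h, h'⟩⟩
  let := TopologicalSpace.upgradeIsCompletelyMetrizable C
  have hd : Dense (⋂ k, W k) := dense_iInter_of_isOpen hWo hWd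
  have hsub : (⋂ k, W k) ⊆ {p : C × C | f p.1 = f p.2} := by
    rintro ⟨p, q⟩ h
    refine (had p q).resolve_right (infinite_of_forall_exists_gt fun k => ?_)
    obtain ⟨m, hm, hmp⟩ := mem_iUnion₂.1 (mem_iInter.1 h (k + 1))
    exact ⟨m, hmp, hm⟩
  have hcl : IsClosed {p : C × C | f p.1 = f p.2} := by
    have heq : {p : C × C | f p.1 = f p.2} = ⋂ m, {p | m ∈ f p.1 ↔ m ∈ f p.2} := by
      ext p
      simp [Set.ext_iff]
    rw [heq]
    refine isClosed_iInter fun m => ?_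
    have h1 := (hf m).preimage (continuous_fst (X := C) (Y := C))
    have h2 := (hf m).preimage (continuous_snd (X := C) (Y := C))
    convert ((h1.inter h2).union (h1.compl.inter h2.compl)).isClosed using 1
    ext p
    exact iff_iff_and_or_not_and_not
  exact (hcl.closure_eq ▸ hd.mono hsub (y, y') : (y, y') ∈ {p : C × C | f p.1 = f p.2})

theorem exists_meetsInfinitelyMany_forall_finite_inter {Y : Type*} [TopologicalSpace Y]
    [PolishSpace Y] {a : ℕ → Set ℕ} {f : Y → Set ℕ} (hf : ∀ m, IsClopen {y | m ∈ f y})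
    (had : ∀ y y', f y = f y' ∨ (f y ∩ f y').Finite)
    (ha : Pairwise fun i j => (a i ∩ a j).Finite) (hfa : ∀ y n, (f y ∩ a n).Finite)
    (hinf : ∀ n, (a n).Infinite) :
    ∃ R, MeetsInfinitelyMany a R ∧ ∀ y, (f y ∩ R).Finite := by
  obtain ⟨B, hBc, -, hB⟩ := TopologicalSpace.exists_countable_basis Y
  obtain ⟨U, hU⟩ := (hBc.insert ∅).exists_eq_range (insert_nonempty _ _)
  have huniv : MeetsInfinitelyMany a univ :=
    Frequently.of_forall fun n => by simpa using hinf n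
  obtain ⟨R, hR, hdec⟩ := MeetsInfinitelyMany.exists_decides U ha hfa huniv
  have hdecB : ∀ V ∈ B, (∀ y ∈ V, (f y ∩ R).Finite) ∨
      ∀ S ⊆ R, MeetsInfinitelyMany a S → ¬ ∀ y ∈ V, (f y ∩ S).Finite := by
    intro V hV
    obtain ⟨i, rfl⟩ : V ∈ range U := hU ▸ mem_insert_of_mem _ hV
    exact hdec i
  let K : Set Y := ⋃₀ {V ∈ B | ∀ y ∈ V, (f y ∩ R).Finite}
  have hK : ∀ y ∈ K, (f y ∩ R).Finite := by
    rintro y ⟨V, ⟨-, hV⟩, hy⟩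
    exact hV y hy
  have hKo : IsOpen K := isOpen_sUnion fun V hV => hB.isOpen hV.1
  have hlarge : ∀ O : Set Y, IsOpen O → ∀ p ∈ O, p ∉ K → ∀ S ⊆ R, MeetsInfinitelyMany a S →
      ¬ ∀ y ∈ O, y ∉ K → (f y ∩ S).Finite := by
    intro O hO p hp hpK S hSR hS hfin
    obtain ⟨V, hV, hpV, hVO⟩ := hB.exists_subset_of_mem_open hp hO
    rcases hdecB V hV with h | h
    · exact hpK ⟨V, ⟨hV, h⟩, hpV⟩
    · refine h S hSR hS fun y hy => ?_
      by_cases hyK : y ∈ K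
      · exact (hK y hyK).subset (inter_subset_inter_right _ hSR)
      · exact hfin y (hVO hy) hyK
  have hpolish : PolishSpace ↥Kᶜ := hKo.isClosed_compl.polishSpace
  have hconst : ∀ p q : ↥Kᶜ, f p = f q := by
    refine eq_of_dense_infinite_inter (C := ↥Kᶜ) (f := fun y => f y)
      (fun m => (hf m).preimage continuous_subtype_val) (fun y y' => had y y') ?_
    rintro _ _ ⟨O, hO, rfl⟩ ⟨O', hO', rfl⟩ ⟨p, hp⟩ ⟨q, hq⟩ k
    by_contra! hno
    let E : Set ℕ := {m | ∃ y ∈ O, y ∉ K ∧ m ∈ f y}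
    have hE : ¬ MeetsInfinitelyMany a (R \ E) := fun h =>
      hlarge O hO p hp p.2 _ sdiff_subset h fun y hy hyK => by
        convert finite_empty
        ext m
        simp only [mem_inter_iff, Set.mem_sdiff, mem_empty_iff_false, iff_false]
        exact fun hm => hm.2.2 ⟨y, hy, hyK, hm.1⟩
    have hRE := (hR.inter_or_diff E).resolve_right hE
    refine hlarge O' hO' q hq q.2 _ inter_subset_left hRE fun y hy hyK =>
      (finite_Iio k).subset ?_
    rintro m ⟨hmy, -, x, hx, hxK, hmx⟩
    by_contra hmk
    exact hno m (not_lt.1 hmk) ⟨x, hxK⟩ hx ⟨y, hyK⟩ hy hmx hmy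
  refine ⟨R, hR, ?_⟩
  by_contra! hex
  obtain ⟨p, hp⟩ := hex
  have hpK : p ∉ K := fun h => hp (hK p h)
  rcases hR.inter_or_diff (f p) with h | h
  · refine MeetsInfinitelyMany.not_of_finite (fun n => (hfa p n).subset ?_) h
    exact inter_subset_inter_left _ inter_subset_right
  · refine hlarge univ isOpen_univ p (mem_univ _) hpK _ sdiff_subset h fun y _ hyK => ?_
    rw [hconst ⟨y, hyK⟩ ⟨p, hpK⟩]
    simp

theorem MeasureTheory.AnalyticSet.inter_of_t2 {α : Type*} [TopologicalSpace α] [T2Space α]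
    {s t : Set α} (hs : AnalyticSet s) (ht : AnalyticSet t) : AnalyticSet (s ∩ t) := by
  rw [inter_eq_iInter]
  exact AnalyticSet.iInter fun b => by cases b <;> assumption

theorem no_analytic_mad_family (𝒜 : Set (Set ℕ))
    (han : IsAnalyticFam 𝒜) (hinf : 𝒜.Infinite)
    (hmem : ∀ x ∈ 𝒜, x.Infinite) (had : AlmostDisjointFam 𝒜) :
    ∃ z : Set ℕ, z.Infinite ∧ ∀ x ∈ 𝒜, (z ∩ x).Finite := by
  classical
  let e : (ℕ → Bool) → Set ℕ := fun x => {n | x n = true}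
  have he : Function.Injective e := fun x y h => by
    funext n
    exact Bool.eq_iff_iff.2 (Set.ext_iff.1 h n)
  let a : ℕ → Set ℕ := fun n => hinf.natEmbedding 𝒜 n
  have haA : ∀ n, a n ∈ 𝒜 := fun n => (hinf.natEmbedding 𝒜 n).2
  have ha : Pairwise fun i j => (a i ∩ a j).Finite := fun i j hij =>
    (had _ (haA i) _ (haA j)).resolve_left fun h =>
      hij ((hinf.natEmbedding 𝒜).injective (Subtype.ext h))
  have : PolishSpace Bool :=
    ((continuous_of_discreteTopology (f := Bool.toNat)).isClosedEmbedding
      (by decide)).polishSpace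
  have hcount : (e ⁻¹' range a).Countable := (countable_range a).preimage_of_injOn he.injOn
  have han' : AnalyticSet (e ⁻¹' 𝒜 ∩ (e ⁻¹' range a)ᶜ) :=
    AnalyticSet.inter_of_t2 han hcount.measurableSet.compl.analyticSet
  obtain ⟨Y, _, _, g, hg, hrange⟩ := analyticSet_iff_exists_polishSpace_range.1 han'
  have hgmem : ∀ y, e (g y) ∈ 𝒜 ∧ e (g y) ∉ range a := fun y => by
    have h : g y ∈ e ⁻¹' 𝒜 ∩ (e ⁻¹' range a)ᶜ := hrange ▸ mem_range_self y
    exact h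
  obtain ⟨R, hR, hfin⟩ := exists_meetsInfinitelyMany_forall_finite_inter (a := a)
    (f := fun y => e (g y))
    (fun m => (isClopen_discrete {true}).preimage ((continuous_apply m).comp hg))
    (fun y y' => had _ (hgmem y).1 _ (hgmem y').1) ha
    (fun y n => (had _ (hgmem y).1 _ (haA n)).resolve_left fun h => (hgmem y).2 ⟨n, h.symm⟩)
    (fun n => hmem _ (haA n))
  obtain ⟨z, hzR, hz, hza⟩ := hR.exists_infinite_subset ha
  refine ⟨z, hz, fun x hx => ?_⟩
  by_cases hxa : x ∈ range a
  · obtain ⟨n, rfl⟩ := hxa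
    exact hza n
  · have hex : e (fun n => decide (n ∈ x)) = x := by
      ext n
      simp [e]
    have hmem' : (fun n => decide (n ∈ x)) ∈ e ⁻¹' 𝒜 ∩ (e ⁻¹' range a)ᶜ := by
      constructor
      · rwa [mem_preimage, hex]
      · rwa [mem_compl_iff, mem_preimage, hex]
    rw [← hrange] at hmem'
    obtain ⟨y, hy⟩ := hmem'
    have hxy := hfin y
    simp only [hy, hex] at hxy
    exact hxy.subset fun m hm => ⟨hm.2, hzR hm.1⟩
end

section
/- Every infinite analytic almost disjoint family 𝒜 ⊆ 𝒫(ω) is contained in a proper countably generated ideal on ω: there is a countable sequence (Aₙ) of subsets of ω such that every x ∈ 𝒜 is almost contained in a finite union of the Aₙ, and no finite union of the Aₙ is cofinite in ω. -/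
open Set Filter TopologicalSpace

/-- An infinite almost disjoint family of infinite sets is avoided by a nonprincipal ultrafilter. -/
theorem AlmostDisjointFam.exists_ultrafilter {𝒜 : Set (Set ℕ)} (had : AlmostDisjointFam 𝒜)
    (hinf : 𝒜.Infinite) (hmem : ∀ x ∈ 𝒜, x.Infinite) :
    ∃ 𝒰 : Ultrafilter ℕ, (𝒰 : Filter ℕ) ≤ cofinite ∧ ∀ x ∈ 𝒜, xᶜ ∈ 𝒰 := by
  let s : Set (Set ℕ) := {c | ∃ x ∈ 𝒜, (cᶜ \ x).Finite}
  have hne : (generate s).NeBot := by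
    rw [generate_neBot_iff]
    intro t hts htf
    choose! g hg hgf using (fun c hc => hts hc : ∀ c ∈ t, ∃ x ∈ 𝒜, (cᶜ \ x).Finite)
    obtain ⟨y, hy, hyt⟩ := hinf.exists_notMem_finite (htf.image g)
    have hfin : (y \ ⋂₀ t).Finite := by
      refine (htf.biUnion (t := fun c => (y ∩ g c) ∪ (cᶜ \ g c)) fun c hc => ?_).subset ?_
      · refine Finite.union ?_ (hgf c hc)
        rcases had y hy (g c) (hg c hc) with h | h
        · exact absurd ⟨c, hc, h.symm⟩ hyt
        · exact h
      · rintro n ⟨hny, hnt⟩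
        simp only [mem_sInter, not_forall] at hnt
        obtain ⟨c, hc, hnc⟩ := hnt
        refine mem_biUnion hc ?_
        by_cases hn : n ∈ g c
        · exact Or.inl ⟨hny, hn⟩
        · exact Or.inr ⟨hnc, hn⟩
    by_contra hemp
    rw [not_nonempty_iff_eq_empty.mp hemp, sdiff_empty] at hfin
    exact hmem y hy hfin
  refine ⟨Ultrafilter.of (generate s), fun c hc => ?_, fun x hx => ?_⟩
  · obtain ⟨x, hx⟩ := hinf.nonempty
    exact Ultrafilter.of_le _ (mem_generate_of_mem ⟨x, hx, (mem_cofinite.mp hc).subset sdiff_subset⟩)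
  · exact Ultrafilter.of_le _ (mem_generate_of_mem ⟨x, hx, by simp⟩)

/-- If the union of the sets coded on any nonempty open set belongs to a fixed nonprincipal filter,
then a dense set of pairs of points codes sets with infinite intersection. -/
theorem dense_setOf_infinite_inter {X : Type*} [TopologicalSpace X] [BaireSpace (X × X)]
    {f : X → ℕ → Bool} (hf : Continuous f) {l : Filter ℕ} [l.NeBot] (hl : l ≤ cofinite)
    (h : ∀ U : Set X, IsOpen U → U.Nonempty → {n | ∃ x ∈ U, f x n = true} ∈ l) :
    Dense {p : X × X | ({n | f p.1 n = true} ∩ {n | f p.2 n = true}).Infinite} := by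
  have hopen : ∀ m, IsOpen {x | f x m = true} := fun m =>
    (isOpen_discrete {true}).preimage ((continuous_apply m).comp hf)
  let W : ℕ → Set (X × X) := fun k => ⋃ m ≥ k, {x | f x m = true} ×ˢ {x | f x m = true}
  have hW : Dense (⋂ k, W k) := by
    refine dense_iInter_of_isOpen
      (fun k => isOpen_biUnion fun m _ => (hopen m).prod (hopen m)) fun k => ?_
    rw [dense_iff_inter_open]
    rintro O hO ⟨⟨a, b⟩, hab⟩
    obtain ⟨U, V, hU, hV, ha, hb, hUV⟩ := isOpen_prod_iff.mp hO a b hab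
    have hk : {m | k ≤ m} ∈ l := hl (Nat.cofinite_eq_atTop ▸ eventually_ge_atTop k)
    obtain ⟨m, ⟨⟨x, hx, hxm⟩, y, hy, hym⟩, hkm⟩ := Filter.nonempty_of_mem
      (inter_mem (inter_mem (h U hU ⟨a, ha⟩) (h V hV ⟨b, hb⟩)) hk)
    exact ⟨(x, y), hUV ⟨hx, hy⟩, mem_biUnion (show m ≥ k from hkm) ⟨hxm, hym⟩⟩
  refine hW.mono fun p hp => Set.infinite_of_forall_exists_gt fun k => ?_
  obtain ⟨m, hkm, hm⟩ := mem_iUnion₂.mp (mem_iInter.mp hp (k + 1))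
  exact ⟨m, hm, hkm⟩

/-- A continuous Polish parametrization of an almost disjoint family whose members avoid a
nonprincipal ultrafilter is covered by countably many sets avoiding the ultrafilter. -/
theorem exists_countable_cover_of_almostDisjoint {X : Type*} [TopologicalSpace X] [PolishSpace X]
    {f : X → ℕ → Bool} (hf : Continuous f) {𝒰 : Ultrafilter ℕ} (h𝒰 : (𝒰 : Filter ℕ) ≤ cofinite)
    (hcompl : ∀ x, {n | f x n = true}ᶜ ∈ 𝒰)
    (had : ∀ x y, f x = f y ∨ ({n | f x n = true} ∩ {n | f y n = true}).Finite) :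
    ∃ S : Set (Set ℕ), S.Countable ∧ (∀ a ∈ S, aᶜ ∈ 𝒰) ∧
      ∀ x, ∃ a ∈ S, {n | f x n = true} ⊆ a := by
  let Cov : Set X → Prop := fun V => ∃ S : Set (Set ℕ), S.Countable ∧ (∀ a ∈ S, aᶜ ∈ 𝒰) ∧
    ∀ x ∈ V, ∃ a ∈ S, {n | f x n = true} ⊆ a
  let B : Set (Set X) := {U ∈ countableBasis X | Cov U}
  have hB : Cov (⋃₀ B) := by
    choose! S hSc hS𝒰 hS using fun U (hU : U ∈ B) => hU.2
    refine ⟨⋃ U ∈ B, S U, ((countable_countableBasis X).mono (sep_subset _ _)).biUnion hSc, ?_, ?_⟩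
    · intro a ha
      obtain ⟨U, hU, haU⟩ := mem_iUnion₂.mp ha
      exact hS𝒰 U hU a haU
    · rintro x ⟨U, hU, hx⟩
      obtain ⟨a, ha, hxa⟩ := hS U hU x hx
      exact ⟨a, mem_biUnion hU ha, hxa⟩
  let C : Set X := (⋃₀ B)ᶜ
  have hCclosed : IsClosed C :=
    (isOpen_sUnion fun U hU => isOpen_of_mem_countableBasis hU.1).isClosed_compl
  have hbasic : ∀ U ∈ countableBasis X, (U ∩ C).Nonempty →
      {n | ∃ x ∈ U ∩ C, f x n = true} ∈ 𝒰 := by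
    rintro U hU ⟨z, hzU, hzC⟩
    by_contra hnot
    refine hzC ⟨U, ⟨hU, ?_⟩, hzU⟩
    obtain ⟨S, hSc, hS𝒰, hS⟩ := hB
    refine ⟨insert {n | ∃ x ∈ U ∩ C, f x n = true} S, hSc.insert _, ?_, fun x hx => ?_⟩
    · rintro a (rfl | ha)
      · exact Ultrafilter.compl_mem_iff_notMem.mpr hnot
      · exact hS𝒰 a ha
    · by_cases hxC : x ∈ C
      · exact ⟨_, mem_insert _ _, fun n hn => ⟨x, ⟨hx, hxC⟩, hn⟩⟩
      · obtain ⟨a, ha, hxa⟩ := hS x (not_not.mp hxC)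
        exact ⟨a, mem_insert_of_mem _ ha, hxa⟩
  have hlarge : ∀ O : Set C, IsOpen O → O.Nonempty →
      {n | ∃ x ∈ O, f (x : X) n = true} ∈ (𝒰 : Filter ℕ) := by
    rintro O hO ⟨z, hz⟩
    obtain ⟨V, hV, rfl⟩ := isOpen_induced_iff.mp hO
    obtain ⟨U, hU, hzU, hUV⟩ := (isBasis_countableBasis X).exists_subset_of_mem_open hz hV
    refine mem_of_superset (hbasic U hU ⟨z, hzU, z.2⟩) ?_
    rintro n ⟨x, ⟨hxU, hxC⟩, hn⟩
    exact ⟨⟨x, hxC⟩, hUV hxU, hn⟩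
  have hCempty : C = ∅ := by
    by_contra hne
    obtain ⟨z, hz⟩ := nonempty_iff_ne_empty.mpr hne
    have : PolishSpace C := hCclosed.polishSpace
    have hfC : Continuous fun x : C => f x := hf.comp continuous_subtype_val
    have hdense : Dense {p : C × C | f p.1 = f p.2} :=
      (dense_setOf_infinite_inter hfC h𝒰 hlarge).mono fun p hp =>
        (had p.1 p.2).resolve_right hp
    have hconst : ∀ x : C, f x = f z := fun x => by
      have hcl : IsClosed {p : C × C | f p.1 = f p.2} :=
        isClosed_eq (hfC.comp continuous_fst) (hfC.comp continuous_snd)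
      exact (hcl.closure_eq ▸ hdense (x, ⟨z, hz⟩) :)
    refine Ultrafilter.compl_mem_iff_notMem.mp (hcompl z)
      (mem_of_superset (hlarge univ isOpen_univ ⟨⟨z, hz⟩, mem_univ _⟩) ?_)
    rintro n ⟨x, -, hn⟩
    rwa [hconst x] at hn
  obtain ⟨S, hSc, hS𝒰, hS⟩ := hB
  exact ⟨S, hSc, hS𝒰, fun x => hS x (compl_empty_iff.mp hCempty ▸ mem_univ x)⟩

/-!
STATEMENT 7: every infinite analytic almost disjoint family is contained in a proper
countably generated ideal on `ω`: there is a sequence `(Aₙ)` of subsets of `ω` such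
that every `x ∈ 𝒜` is almost contained in a finite union of the `Aₙ`, while no
finite union of the `Aₙ` is cofinite.
-/

theorem analytic_ad_family_in_countably_generated_ideal (𝒜 : Set (Set ℕ))
    (han : IsAnalyticFam 𝒜) (hinf : 𝒜.Infinite)
    (hmem : ∀ x ∈ 𝒜, x.Infinite) (had : AlmostDisjointFam 𝒜) :
    ∃ A : ℕ → Set ℕ,
      (∀ x ∈ 𝒜, ∃ F : Finset ℕ, (x \ ⋃ n ∈ F, A n).Finite) ∧
      (∀ F : Finset ℕ, ((⋃ n ∈ F, A n)ᶜ : Set ℕ).Infinite) := by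
  obtain ⟨𝒰, h𝒰, hcompl⟩ := had.exists_ultrafilter hinf hmem
  have hcode : ∀ x : Set ℕ, ∃ c : ℕ → Bool, {n | c n = true} = x := fun x => by
    classical exact ⟨fun n => decide (n ∈ x), by simp⟩
  rw [IsAnalyticFam, MeasureTheory.AnalyticSet] at han
  rcases han with hempty | ⟨f, hf, hrange⟩
  · obtain ⟨x, hx⟩ := hinf.nonempty
    obtain ⟨c, rfl⟩ := hcode x
    exact absurd (show c ∈ {x : ℕ → Bool | {n | x n = true} ∈ 𝒜} from hx) (by simp [hempty])
  have hf𝒜 : ∀ z, {n | f z n = true} ∈ 𝒜 := fun z =>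
    (hrange ▸ mem_range_self z : f z ∈ {x : ℕ → Bool | {n | x n = true} ∈ 𝒜})
  obtain ⟨S, hSc, hS𝒰, hS⟩ := exists_countable_cover_of_almostDisjoint hf h𝒰
    (fun z => hcompl _ (hf𝒜 z)) fun x y => (had _ (hf𝒜 x) _ (hf𝒜 y)).imp_left fun h => by
      funext n
      exact Bool.eq_iff_iff.mpr (Set.ext_iff.mp h n)
  obtain ⟨a, ha, -⟩ := hS 0
  obtain ⟨A, rfl⟩ := hSc.exists_eq_range ⟨a, ha⟩
  refine ⟨A, fun x hx => ?_, fun F hfin => ?_⟩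
  · obtain ⟨c, rfl⟩ := hcode x
    obtain ⟨z, rfl⟩ : c ∈ range f := hrange ▸ hx
    obtain ⟨_, ⟨n, rfl⟩, hn⟩ := hS z
    refine ⟨{n}, ?_⟩
    simp [sdiff_eq_empty.mpr hn]
  · have hmem𝒰 : (⋃ n ∈ F, A n)ᶜ ∈ (𝒰 : Filter ℕ) := by
      simp only [compl_iUnion]
      exact (biInter_finset_mem F).mpr fun n _ => hS𝒰 _ (mem_range_self n)
    exact Ultrafilter.compl_mem_iff_notMem.mp (h𝒰 hfin.compl_mem_cofinite) hmem𝒰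
end
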